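/- arXiv:1409.7029 — 3 statements merged into one kernel-verified Lean document; each statement's English description precedes it below -/
import Mathlib

section
/- For all positive integers n and g there exists an integer d₀, depending only on n and g, with the following property: if d > d₀ and H is a subgroup of (ℤ/dℤ)ˣ of index at most 2g, then every coset of H in (ℤ/dℤ)ˣ contains an element whose least positive residue lies in the open interval (0, d/n). -/
theorem inv_card_add_one_le_prod (s : Finset ℕ) (hs : ∀ p ∈ s, 2 ≤ p) :
    ((s.card : ℝ) + 1)⁻¹ ≤ ∏ p ∈ s, (1 - (p : ℝ)⁻¹) := by
  induction s using Finset.induction_on_max with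
  | empty => simp
  | insert a s ha ih =>
    have has : a ∉ s := fun h ↦ (ha a h).false
    have hcard : s.card + 2 ≤ a := by
      have hsub : s ⊆ Finset.Ico 2 a := fun p hp ↦
        Finset.mem_Ico.2 ⟨hs p (Finset.mem_insert_of_mem hp), ha p hp⟩
      have := Finset.card_le_card hsub
      have := hs a (Finset.mem_insert_self _ _)
      simp at *
      omega
    have ih' := ih fun p hp ↦ hs p (Finset.mem_insert_of_mem hp)
    rw [Finset.prod_insert has, Finset.card_insert_of_notMem has]
    have hcard' : (s.card : ℝ) + 2 ≤ a := by exact_mod_cast hcard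
    have h1 : (a : ℝ)⁻¹ ≤ ((s.card : ℝ) + 2)⁻¹ := inv_anti₀ (by positivity) hcard'
    calc ((↑(s.card + 1) : ℝ) + 1)⁻¹
        = (1 - ((s.card : ℝ) + 2)⁻¹) * ((s.card : ℝ) + 1)⁻¹ := by
          push_cast; field_simp; ring
      _ ≤ _ := by
          have : ((s.card : ℝ) + 2)⁻¹ ≤ 1 := inv_le_one_of_one_le₀ <| by
            linarith [(s.card).cast_nonneg (α := ℝ)]
          gcongr
          linarith

theorem div_log_add_one_le_totient (d : ℕ) (hd : d ≠ 0) :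
    (d : ℝ) / (Nat.log 2 d + 1) ≤ d.totient := by
  have hcard : d.primeFactors.card ≤ Nat.log 2 d := by
    refine Nat.le_log_of_pow_le one_lt_two ?_
    calc 2 ^ d.primeFactors.card ≤ ∏ p ∈ d.primeFactors, p :=
          Finset.pow_card_le_prod _ _ _ fun p hp ↦ (Nat.prime_of_mem_primeFactors hp).two_le
      _ ≤ d := Nat.le_of_dvd (Nat.pos_of_ne_zero hd) (Nat.prod_primeFactors_dvd d)
  have h := Nat.totient_eq_mul_prod_factors d
  have h' : (d.totient : ℝ) = d * ∏ p ∈ d.primeFactors, (1 - (p : ℝ)⁻¹) := by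
    simpa using congrArg (Rat.cast : ℚ → ℝ) h
  rw [h', div_eq_mul_inv]
  gcongr
  refine le_trans ?_ (inv_card_add_one_le_prod _ fun p hp ↦
    (Nat.prime_of_mem_primeFactors hp).two_le)
  gcongr

open Filter in
theorem eventually_mul_sqrt_lt_totient (C : ℝ) :
    ∀ᶠ d : ℕ in atTop, C * √d < d.totient := by
  have hlim : Tendsto (fun x : ℝ ↦ (Real.log x / Real.log 2 + 1) / x ^ (1 / 2 : ℝ))
      atTop (nhds 0) := by
    have h1 := (isLittleO_log_rpow_atTop (r := 1 / 2) (by norm_num)).tendsto_div_nhds_zero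
    have h2 := (tendsto_rpow_neg_atTop (y := 1 / 2) (by norm_num))
    have h3 := (h1.div_const (Real.log 2)).add h2
    simp only [zero_div, add_zero] at h3
    refine h3.congr' ?_
    filter_upwards [eventually_gt_atTop 0] with x hx
    rw [Real.rpow_neg hx.le]
    ring
  have hC : 0 < (|C| + 1)⁻¹ := by positivity
  filter_upwards [(hlim.comp tendsto_natCast_atTop_atTop).eventually (gt_mem_nhds hC),
    eventually_gt_atTop 0] with d hd hd0
  have hd0' : (0 : ℝ) < d := by exact_mod_cast hd0
  refine lt_of_lt_of_le ?_ (div_log_add_one_le_totient d hd0.ne')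
  have hlog : (Nat.log 2 d : ℝ) ≤ Real.log d / Real.log 2 := by
    have := Real.natLog_le_logb d 2
    simpa [Real.logb] using this
  simp only [Function.comp, ← Real.sqrt_eq_rpow] at hd
  have hs : 0 < √(d : ℝ) := Real.sqrt_pos.2 hd0'
  rw [div_lt_iff₀ hs, inv_mul_eq_div, lt_div_iff₀ (by positivity)] at hd
  rw [lt_div_iff₀ (by positivity)]
  have hsq : √(d : ℝ) * √d = d := Real.mul_self_sqrt hd0'.le
  have hL : (0 : ℝ) < Nat.log 2 d + 1 := by positivity
  have : C * (Nat.log 2 d + 1) < √(d : ℝ) := by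
    nlinarith [le_abs_self C, abs_nonneg C]
  nlinarith

theorem card_filter_natCast_mul_eq_le {d : ℕ} [NeZero d] {a : ℕ} (ha : 0 < a) (b : ZMod d) :
    (Finset.univ.filter fun z : ZMod d ↦ (a : ZMod d) * z = b).card ≤ a := by
  conv_rhs => rw [← Finset.card_range a]
  refine Finset.card_le_card_of_injOn (fun z ↦ a * z.val / d) (fun z _ ↦ ?_) ?_
  · simp only [Finset.coe_range, Set.mem_Iio]
    rw [Nat.div_lt_iff_lt_mul (NeZero.pos d)]
    exact Nat.mul_lt_mul_of_pos_left z.val_lt ha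
  · intro z hz w hw hzw
    simp only [Finset.coe_filter, Finset.mem_univ, true_and, Set.mem_ofPred_eq] at hz hw
    have hmod : a * z.val ≡ a * w.val [MOD d] := by
      rw [← ZMod.natCast_eq_natCast_iff]
      simp [hz, hw]
    have : a * z.val = a * w.val := by
      rw [← Nat.div_add_mod (a * z.val) d, ← Nat.div_add_mod (a * w.val) d, hmod]
      simp only at hzw
      rw [hzw]
    exact ZMod.val_injective d (Nat.eq_of_mul_eq_mul_left ha this)

/-- Parseval's identity for the exponential sum over an injective family in `ℤ/dℤ`. -/
theorem sum_sq_norm_sum_stdAddChar {d : ℕ} [NeZero d] {ι : Type*} [Fintype ι] {f : ι → ZMod d}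
    (hf : Function.Injective f) :
    ∑ b : ZMod d, ‖∑ i, ZMod.stdAddChar (b * f i)‖ ^ 2 = d * Fintype.card ι := by
  classical
  have key : ∀ b : ZMod d, ((‖∑ i, ZMod.stdAddChar (b * f i)‖ ^ 2 : ℝ) : ℂ) =
      ∑ i, ∑ j, ZMod.stdAddChar (b * (f i - f j)) := fun b ↦ by
    rw [Complex.ofReal_pow, ← Complex.mul_conj', map_sum, Finset.sum_mul_sum]
    refine Finset.sum_congr rfl fun i _ ↦ Finset.sum_congr rfl fun j _ ↦ ?_
    rw [← AddChar.map_neg_eq_conj, ← AddChar.map_add_eq_mul]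
    ring_nf
  apply Complex.ofReal_injective
  rw [Complex.ofReal_sum, Finset.sum_congr rfl fun b _ ↦ key b, Finset.sum_comm]
  simp_rw [Finset.sum_comm (s := (Finset.univ : Finset (ZMod d))),
    AddChar.sum_mulShift _ (ZMod.isPrimitive_stdAddChar d), sub_eq_zero, hf.eq_iff]
  simp [mul_comm]

/-- The exponential sum over a coset of `H` at frequency `a > 0` is at most `√(a d)`: it is constant
on the orbit of `a` under `H`, each point of which has at most `a` preimages in `H`. -/
theorem sq_norm_sum_coset_le {d : ℕ} [NeZero d] (H : Subgroup (ZMod d)ˣ) [Fintype H]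
    (u : (ZMod d)ˣ) {a : ℕ} (ha : 0 < a) :
    ‖∑ h : H, ZMod.stdAddChar ((a : ZMod d) * ((u * h : (ZMod d)ˣ) : ZMod d))‖ ^ 2 ≤ a * d := by
  classical
  set T : ZMod d → ℝ := fun b ↦
    ‖∑ h : H, ZMod.stdAddChar (b * ((u * h : (ZMod d)ˣ) : ZMod d))‖ ^ 2 with hT
  have hinj : Function.Injective fun h : H ↦ ((u * h : (ZMod d)ˣ) : ZMod d) := fun h k hhk ↦
    Subtype.ext (mul_left_cancel (Units.ext hhk))
  have hinv (k : H) : T (a * ((k : (ZMod d)ˣ) : ZMod d)) = T a := by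
    simp only [hT]
    congr 2
    refine Fintype.sum_equiv (Equiv.mulLeft k) _ _ fun h ↦ ?_
    congr 1
    simp only [Equiv.coe_mulLeft, Subgroup.coe_mul, Units.val_mul]
    ring
  have hfib (b : ZMod d) :
      (Finset.univ.filter fun k : H ↦ (a : ZMod d) * ((k : (ZMod d)ˣ) : ZMod d) = b).card ≤ a := by
    refine le_trans ?_ (card_filter_natCast_mul_eq_le ha b)
    refine Finset.card_le_card_of_injOn (fun k : H ↦ ((k : (ZMod d)ˣ) : ZMod d)) ?_ ?_
    · intro k hk
      simpa using hk
    · intro k _ l _ hkl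
      exact Subtype.ext (Units.ext hkl)
  have hcard : (0 : ℝ) < Fintype.card H := by exact_mod_cast Fintype.card_pos
  have hsum : Fintype.card H * T a ≤ Fintype.card H * (a * d) := by
    calc Fintype.card H * T a = ∑ k : H, T (a * ((k : (ZMod d)ˣ) : ZMod d)) := by simp [hinv]
      _ = ∑ b, ∑ k ∈ Finset.univ.filter fun k : H ↦ (a : ZMod d) * ((k : (ZMod d)ˣ) : ZMod d) = b,
            T (a * ((k : (ZMod d)ˣ) : ZMod d)) := (Finset.sum_fiberwise _ _ _).symm
      _ ≤ ∑ b, a * T b := by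
          refine Finset.sum_le_sum fun b _ ↦ ?_
          rw [Finset.sum_congr rfl fun k hk ↦ by rw [(Finset.mem_filter.1 hk).2],
            Finset.sum_const, nsmul_eq_mul]
          have : 0 ≤ T b := by positivity
          gcongr
          exact hfib b
      _ = Fintype.card H * (a * d) := by
          rw [← Finset.mul_sum, sum_sq_norm_sum_stdAddChar hinj]
          ring
  exact le_of_mul_le_mul_left hsum hcard

theorem norm_one_add_exp_le {t n : ℝ} (hn : 1 ≤ n) (ht : 1 / n ≤ t) (ht1 : t < 1) :
    ‖1 + Complex.exp (((2 * Real.pi * (t - 1 / (2 * n)) : ℝ) : ℂ) * Complex.I)‖ ≤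
      2 * Real.cos (Real.pi / (2 * n)) := by
  set s := t - 1 / (2 * n) with hs
  have hhalf : 1 / n = 2 * (1 / (2 * n)) := by field_simp
  have hn2 : 1 / (2 * n) ≤ 1 / 2 := by gcongr; linarith
  have hn0 : 0 < 1 / (2 * n) := by positivity
  have hpi := Real.pi_pos
  have hle : 1 / (2 * n) ≤ s := by linarith
  have hge : s ≤ 1 - 1 / (2 * n) := by linarith
  have hdiv : Real.pi / (2 * n) = Real.pi * (1 / (2 * n)) := by ring
  have hcos : |Real.cos (Real.pi * s)| ≤ Real.cos (Real.pi / (2 * n)) := by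
    rw [hdiv, abs_le]
    constructor
    · rw [← Real.cos_pi_sub]
      apply Real.cos_le_cos_of_nonneg_of_le_pi <;> nlinarith
    · apply Real.cos_le_cos_of_nonneg_of_le_pi <;> nlinarith
  have hfactor : 1 + Complex.exp (((2 * Real.pi * s : ℝ) : ℂ) * Complex.I) =
      Complex.exp (((Real.pi * s : ℝ) : ℂ) * Complex.I) * ((2 * Real.cos (Real.pi * s) : ℝ) : ℂ) := by
    push_cast
    rw [Complex.two_cos, mul_add, ← Complex.exp_add, ← Complex.exp_add, add_comm]
    congr 1
    · ring_nf
    · rw [show ((Real.pi : ℂ) * s * Complex.I + -(Real.pi * s) * Complex.I) = 0 by ring,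
        Complex.exp_zero]
  rw [hfactor, norm_mul, Complex.norm_exp_ofReal_mul_I, one_mul, Complex.norm_real,
    Real.norm_eq_abs, abs_mul, abs_two]
  gcongr

theorem norm_sum_coset_natCast_sub_le {d : ℕ} [NeZero d] (H : Subgroup (ZMod d)ˣ) [Fintype H]
    (u : (ZMod d)ˣ) {j M : ℕ} (hj : j ≤ 2 * M) (hne : j ≠ M) :
    ‖∑ h : H, ZMod.stdAddChar (((j : ZMod d) - (M : ZMod d)) * ((u * h : (ZMod d)ˣ) : ZMod d))‖ ≤
      √(M * d) := by
  obtain ⟨a, v, ha, haM, hv⟩ : ∃ (a : ℕ) (v : (ZMod d)ˣ), 0 < a ∧ a ≤ M ∧ ∀ h : (ZMod d)ˣ,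
      ((j : ZMod d) - (M : ZMod d)) * ((u * h : (ZMod d)ˣ) : ZMod d) =
        (a : ZMod d) * ((v * h : (ZMod d)ˣ) : ZMod d) := by
    rcases hne.lt_or_gt with h | h
    · refine ⟨M - j, -u, by omega, by omega, fun k ↦ ?_⟩
      rw [Nat.cast_sub h.le]
      simp only [Units.val_mul, Units.val_neg]
      ring
    · refine ⟨j - M, u, by omega, by omega, fun k ↦ ?_⟩
      rw [Nat.cast_sub h.le]
  simp_rw [hv]
  refine Real.le_sqrt_of_sq_le ((sq_norm_sum_coset_le H v ha).trans ?_)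
  gcongr

/-- If a coset of `H` has no element with residue in `(0, d/n)`, then testing it against the
trigonometric polynomial `t ↦ (2 cos (π (t - 1/(2n)))) ^ (2M)` bounds the size of `H`. -/
theorem centralBinom_mul_card_le {d : ℕ} [NeZero d] (H : Subgroup (ZMod d)ˣ) [Fintype H]
    (x : (ZMod d)ˣ) {n : ℕ} (hn : 0 < n) (M : ℕ)
    (hval : ∀ h ∈ H, (d : ℝ) / n ≤ ((x * h : (ZMod d)ˣ) : ZMod d).val) :
    (M.centralBinom : ℝ) * Fintype.card H ≤
      4 ^ M * ((Real.cos (Real.pi / (2 * n)) ^ 2) ^ M * Fintype.card H + √(M * d)) := by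
  have hd : (0 : ℝ) < d := by exact_mod_cast NeZero.pos d
  have hn1 : (1 : ℝ) ≤ n := by exact_mod_cast hn
  set ζ : ℂ := Complex.exp (((-(Real.pi / n) : ℝ) : ℂ) * Complex.I) with hζ
  have hζn : ‖ζ‖ = 1 := Complex.norm_exp_ofReal_mul_I _
  set w : H → ℂ := fun h ↦ ζ * ZMod.stdAddChar ((x * h : (ZMod d)ˣ) : ZMod d) with hw
  have hwn (h : H) : ‖w h‖ = 1 := by simp [hw, hζn, AddChar.norm_apply]
  have hw1 (h : H) : ‖1 + w h‖ ≤ 2 * Real.cos (Real.pi / (2 * n)) := by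
    set y : ZMod d := ((x * h : (ZMod d)ˣ) : ZMod d) with hy
    have hwexp : w h =
        Complex.exp (((2 * Real.pi * ((y.val : ℝ) / d - 1 / (2 * n)) : ℝ) : ℂ) * Complex.I) := by
      have hyv : y = ((y.val : ℤ) : ZMod d) := by simp
      have hψ := ZMod.stdAddChar_coe (N := d) (y.val : ℤ)
      rw [← hyv] at hψ
      simp only [hw, hζ]
      rw [← hy, hψ, ← Complex.exp_add]
      congr 1
      push_cast
      field_simp
      ring
    rw [hwexp]
    refine norm_one_add_exp_le hn1 ?_ ?_
    · rw [le_div_iff₀ hd, one_div_mul_eq_div]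
      exact hval h h.2
    · rw [div_lt_one hd]
      exact_mod_cast y.val_lt
  set S : ℕ → ℂ := fun j ↦ ∑ h : H, w h ^ j * (w h)⁻¹ ^ M with hS
  have hSM : S M = Fintype.card H := by
    have (h : H) : w h ^ M * (w h)⁻¹ ^ M = 1 := by
      rw [← mul_pow, mul_inv_cancel₀ (norm_ne_zero_iff.1 (by simp [hwn])), one_pow]
    simp only [hS, this]
    simp
  have hSj (j : ℕ) (hj : j ≤ 2 * M) (hne : j ≠ M) : ‖S j‖ ≤ √(M * d) := by
    have : S j = ζ ^ j * ζ⁻¹ ^ M *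
        ∑ h : H, ZMod.stdAddChar (((j : ZMod d) - (M : ZMod d)) * ((x * h : (ZMod d)ˣ) : ZMod d)) := by
      rw [Finset.mul_sum]
      refine Finset.sum_congr rfl fun h _ ↦ ?_
      rw [sub_mul, sub_eq_add_neg, AddChar.map_add_eq_mul, AddChar.map_neg_eq_inv,
        ← nsmul_eq_mul, ← nsmul_eq_mul, AddChar.map_nsmul_eq_pow, AddChar.map_nsmul_eq_pow]
      simp only [hw, mul_pow, mul_inv, inv_pow]
      ring
    rw [this, norm_mul, norm_mul, norm_pow, norm_pow, norm_inv, hζn]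
    simpa using norm_sum_coset_natCast_sub_le H x hj hne
  have hexpand : ∑ h : H, (1 + w h) ^ (2 * M) * (w h)⁻¹ ^ M =
      ∑ j ∈ Finset.range (2 * M + 1), ((2 * M).choose j : ℂ) * S j := by
    simp only [hS, Finset.mul_sum]
    rw [Finset.sum_comm]
    refine Finset.sum_congr rfl fun h _ ↦ ?_
    rw [add_comm, add_pow, Finset.sum_mul]
    refine Finset.sum_congr rfl fun j _ ↦ ?_
    simp only [one_pow]
    ring
  have hupper : ‖∑ h : H, (1 + w h) ^ (2 * M) * (w h)⁻¹ ^ M‖ ≤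
      4 ^ M * ((Real.cos (Real.pi / (2 * n)) ^ 2) ^ M * Fintype.card H) := by
    calc _ ≤ ∑ _h : H, (2 * Real.cos (Real.pi / (2 * n))) ^ (2 * M) := by
          refine norm_sum_le_of_le _ fun h _ ↦ ?_
          rw [norm_mul, norm_pow, norm_pow, norm_inv, hwn, inv_one, one_pow, mul_one]
          gcongr
          exact hw1 h
      _ = _ := by
          rw [Finset.sum_const, nsmul_eq_mul, Finset.card_univ, mul_pow, pow_mul 2,
            pow_mul (Real.cos _)]
          norm_num
          ring
  have hM : M ∈ Finset.range (2 * M + 1) := Finset.mem_range.2 (by omega)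
  rw [hexpand, ← Finset.add_sum_erase _ _ hM, hSM, ← Nat.centralBinom_eq_two_mul_choose] at hupper
  have hrest : ‖∑ j ∈ (Finset.range (2 * M + 1)).erase M, ((2 * M).choose j : ℂ) * S j‖ ≤
      4 ^ M * √(M * d) := by
    calc _ ≤ ∑ j ∈ (Finset.range (2 * M + 1)).erase M, ((2 * M).choose j : ℝ) * √(M * d) := by
          refine norm_sum_le_of_le _ fun j hj ↦ ?_
          rw [Finset.mem_erase, Finset.mem_range] at hj
          rw [norm_mul, Complex.norm_natCast]
          gcongr
          exact hSj j (by omega) hj.1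
      _ ≤ ∑ j ∈ Finset.range (2 * M + 1), ((2 * M).choose j : ℝ) * √(M * d) :=
          Finset.sum_le_sum_of_subset_of_nonneg (Finset.erase_subset _ _) fun _ _ _ ↦ by positivity
      _ = 4 ^ M * √(M * d) := by
          rw [← Finset.sum_mul]
          congr 1
          rw [show (4 : ℝ) = 2 ^ 2 by norm_num, ← pow_mul]
          exact_mod_cast Nat.sum_range_choose (2 * M)
  have htri := norm_le_add_norm_add ((M.centralBinom : ℂ) * (Fintype.card H : ℂ))
    (∑ j ∈ (Finset.range (2 * M + 1)).erase M, ((2 * M).choose j : ℂ) * S j)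
  rw [norm_mul, Complex.norm_natCast, Complex.norm_natCast] at htri
  linarith

/-- For all positive integers `n` and `g` there exists `d₀` (depending only on `n`
and `g`) such that for `d > d₀` and every subgroup `H ≤ (ℤ/dℤ)ˣ` of index at most
`2g`, every coset of `H` contains an element whose least positive residue lies in
the open interval `(0, d/n)`. -/
theorem stmt2 (n g : ℕ) (hn : 0 < n) (hg : 0 < g) :
    ∃ d₀ : ℕ, ∀ d : ℕ, d₀ < d →
      ∀ H : Subgroup (ZMod d)ˣ, H.index ≤ 2 * g →
        ∀ x : (ZMod d)ˣ, ∃ h ∈ H,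
          0 < ((x * h : (ZMod d)ˣ) : ZMod d).val ∧
            (((x * h : (ZMod d)ˣ) : ZMod d).val : ℝ) < (d : ℝ) / n := by
  set c : ℝ := Real.cos (Real.pi / (2 * n)) ^ 2 with hc
  have hc0 : 0 ≤ c := sq_nonneg _
  have hc1 : c < 1 := by
    have hpos : 0 < Real.pi / (2 * n) := by positivity
    have hle : Real.pi / (2 * n) < Real.pi := by
      have : (1 : ℝ) ≤ n := by exact_mod_cast hn
      rw [div_lt_iff₀ (by positivity)]
      nlinarith [Real.pi_pos]
    have := Real.sin_sq_add_cos_sq (Real.pi / (2 * n))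
    have := Real.sin_pos_of_pos_of_lt_pi hpos hle
    nlinarith
  obtain ⟨M, hMc, hM⟩ := (((tendsto_self_mul_const_pow_of_lt_one hc0 hc1).eventually
    (gt_mem_nhds (show (0 : ℝ) < 1 / 4 by norm_num))).and (Filter.eventually_gt_atTop 0)).exists
  obtain ⟨d₀, hd₀⟩ := Filter.eventually_atTop.1
    (eventually_mul_sqrt_lt_totient (4 * M * (2 * g) * √M))
  refine ⟨d₀ + n, fun d hd H hH x ↦ ?_⟩
  have : NeZero d := ⟨by omega⟩
  have : Fact (1 < d) := ⟨by omega⟩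
  by_contra! hcon
  classical
  have hval : ∀ h ∈ H, (d : ℝ) / n ≤ ((x * h : (ZMod d)ˣ) : ZMod d).val := fun h hh ↦
    hcon h hh (ZMod.val_pos.2 (Units.ne_zero _))
  have hmain := centralBinom_mul_card_le H x hn M hval
  rw [← hc] at hmain
  set N : ℝ := (Fintype.card H : ℝ) with hN
  have hN0 : 0 < N := by rw [hN]; exact_mod_cast Fintype.card_pos
  have hM0 : (0 : ℝ) < M := by exact_mod_cast hM
  have htot : (d.totient : ℝ) ≤ 2 * g * N := by
    have h := H.index_mul_card
    rw [Nat.card_eq_fintype_card, Nat.card_eq_fintype_card, ZMod.card_units_eq_totient] at h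
    rw [hN]
    exact_mod_cast h ▸ Nat.mul_le_mul_right _ hH
  have hsqrt : 4 * M * √(M * d) < N := by
    have h := (hd₀ d (by omega)).trans_le htot
    rw [Real.sqrt_mul hM0.le]
    have hg0 : (0 : ℝ) < 2 * g := by positivity
    refine lt_of_mul_lt_mul_left (?_ : 2 * g * (4 * M * (√M * √d)) < 2 * g * N) hg0.le
    linarith
  have hbinom : (4 : ℝ) ^ M ≤ 2 * M * M.centralBinom := by
    exact_mod_cast Nat.four_pow_le_two_mul_self_mul_centralBinom M hM
  have h4 : (0 : ℝ) < 4 ^ M := by positivity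
  have hN1 : 4 ^ M * N ≤ 4 ^ M * (2 * M * (c ^ M * N + √(M * d))) :=
    calc 4 ^ M * N ≤ 2 * M * M.centralBinom * N := by gcongr
      _ = 2 * M * (M.centralBinom * N) := by ring
      _ ≤ 2 * M * (4 ^ M * (c ^ M * N + √(M * d))) := by gcongr
      _ = _ := by ring
  have hN2 := le_of_mul_le_mul_left hN1 h4
  nlinarith
end

section
/- For every positive integer g and all real numbers 0 ≤ α < β ≤ 1, there exists an integer d₀ such that for all d > d₀ and every subgroup H of (ℤ/dℤ)ˣ of index at most 2g, every coset of H in (ℤ/dℤ)ˣ contains an element whose least positive residue b satisfies αd < b < βd. -/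
open Finset MeasureTheory AddCircle

lemma prod_one_sub_inv_ge (s : Finset ℕ) (hs : ∀ p ∈ s, 2 ≤ p) :
    1 / ((#s : ℝ) + 1) ≤ ∏ p ∈ s, (1 - (p : ℝ)⁻¹) := by
  induction s using Finset.induction_on_max with
  | empty => simp
  | insert a s ha ih =>
    have has : a ∉ s := fun h => lt_irrefl _ (ha a h)
    have hcard : #s + 2 ≤ a := by
      have ha2 := hs a (mem_insert_self a s)
      have hsub : s ⊆ Ico 2 a := fun p hp =>
        mem_Ico.2 ⟨hs p (mem_insert_of_mem hp), ha p hp⟩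
      have := card_le_card hsub
      rw [Nat.card_Ico] at this
      omega
    have hcard' : (#s : ℝ) + 2 ≤ a := by exact_mod_cast hcard
    rw [prod_insert has, card_insert_of_notMem has]
    have hfac : ((#s : ℝ) + 1) / (#s + 2) ≤ 1 - (a : ℝ)⁻¹ := by
      have : (a : ℝ)⁻¹ ≤ ((#s : ℝ) + 2)⁻¹ := inv_anti₀ (by positivity) hcard'
      have h2 : ((#s : ℝ) + 1) / (#s + 2) = 1 - ((#s : ℝ) + 2)⁻¹ := by
        field_simp
        ring
      linarith
    calc 1 / (((#s + 1 : ℕ) : ℝ) + 1)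
        = ((#s : ℝ) + 1) / (#s + 2) * (1 / (#s + 1)) := by
          push_cast
          field_simp
          ring
      _ ≤ _ := mul_le_mul hfac (ih fun p hp => hs p (mem_insert_of_mem hp)) (by positivity)
          (le_trans (by positivity) hfac)

lemma succ_pow_four_le (k : ℕ) : (k + 1) ^ 4 ≤ 64 * 2 ^ k := by
  rcases lt_or_ge k 5 with hk | hk
  · interval_cases k <;> norm_num
  · induction k, hk using Nat.le_induction with
    | base => norm_num
    | succ n hn ih =>
      have h : (n + 1 + 1) ^ 4 ≤ 2 * (n + 1) ^ 4 := by
        obtain ⟨m, rfl⟩ := Nat.exists_eq_add_of_le hn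
        ring_nf
        nlinarith [Nat.zero_le m, Nat.zero_le (m ^ 2), Nat.zero_le (m ^ 3), Nat.zero_le (m ^ 4)]
      calc (n + 1 + 1) ^ 4 ≤ 2 * (n + 1) ^ 4 := h
        _ ≤ 2 * (64 * 2 ^ n) := by gcongr
        _ = 64 * 2 ^ (n + 1) := by ring

lemma pow_three_le_totient_pow_four (d : ℕ) (hd : d ≠ 0) :
    (d : ℝ) ^ 3 ≤ 64 * (d.totient : ℝ) ^ 4 := by
  set k := #d.primeFactors with hk
  have hd0 : (0 : ℝ) < d := by positivity
  have h2k : (2 : ℝ) ^ k ≤ d := by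
    have h := Finset.pow_card_le_prod d.primeFactors id 2
      fun p hp => (Nat.prime_of_mem_primeFactors hp).two_le
    exact_mod_cast h.trans (Nat.le_of_dvd (Nat.pos_of_ne_zero hd) (Nat.prod_primeFactors_dvd d))
  have htot : (d : ℝ) ≤ d.totient * (k + 1) := by
    have h := prod_one_sub_inv_ge d.primeFactors
      fun p hp => (Nat.prime_of_mem_primeFactors hp).two_le
    have heq : (d.totient : ℝ) = d * ∏ p ∈ d.primeFactors, (1 - (p : ℝ)⁻¹) := by
      have := congrArg (Rat.cast : ℚ → ℝ) (Nat.totient_eq_mul_prod_factors d)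
      push_cast at this
      exact this
    rw [← hk, div_le_iff₀ (by positivity)] at h
    rw [heq, mul_assoc]
    exact le_mul_of_one_le_right hd0.le h
  have hk4 : ((k : ℝ) + 1) ^ 4 ≤ 64 * d := by
    have h : ((k : ℝ) + 1) ^ 4 ≤ 64 * 2 ^ k := by exact_mod_cast succ_pow_four_le k
    linarith
  have h4 : (d : ℝ) ^ 4 ≤ (d.totient : ℝ) ^ 4 * (64 * d) :=
    calc (d : ℝ) ^ 4 ≤ (d.totient * ((k : ℝ) + 1)) ^ 4 := by gcongr
      _ = (d.totient : ℝ) ^ 4 * ((k : ℝ) + 1) ^ 4 := mul_pow _ _ _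
      _ ≤ _ := by gcongr
  refine le_of_mul_le_mul_right ?_ hd0
  linarith

lemma card_intCast_mul_eq_le {d : ℕ} [NeZero d] {n : ℤ} (hn : n ≠ 0) (m : ZMod d) :
    #{z : ZMod d | (n : ZMod d) * z = m} ≤ n.natAbs := by
  rcases Finset.eq_empty_or_nonempty {z : ZMod d | (n : ZMod d) * z = m} with h | ⟨z₀, hz₀⟩
  · simp [h]
  · refine le_trans ?_ (IsAddCyclic.card_nsmul_eq_zero_le (α := ZMod d) (Int.natAbs_pos.2 hn))
    refine card_le_card_of_injOn (fun z => z - z₀) (fun z hz => ?_)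
      (sub_left_injective.injOn)
    simp only [mem_filter, mem_univ, true_and, coe_filter, Set.mem_ofPred_eq] at hz hz₀ ⊢
    have h0 : n • (z - z₀) = 0 := by rw [zsmul_eq_mul, mul_sub, hz, hz₀, sub_self]
    rcases Int.natAbs_eq n with h | h <;> rw [h] at h0 <;> simpa using h0

section ExponentialSum

variable {d : ℕ} [NeZero d]

/-- The exponential sum of frequency `m` over a finite family of residues modulo `d`. -/
noncomputable def expSum {ι : Type*} [Fintype ι] (b : ι → ZMod d) (m : ZMod d) : ℂ :=
  ∑ i, ZMod.stdAddChar (m * b i)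

lemma sum_norm_expSum_sq {ι : Type*} [Fintype ι] {b : ι → ZMod d} (hb : b.Injective) :
    ∑ m, ‖expSum b m‖ ^ 2 = d * Fintype.card ι := by
  classical
  have key : ∑ m, ((‖expSum b m‖ ^ 2 : ℝ) : ℂ) = d * Fintype.card ι := by
    calc ∑ m, ((‖expSum b m‖ ^ 2 : ℝ) : ℂ)
        = ∑ m, ∑ i, ∑ j, (ZMod.stdAddChar (m * (b i - b j)) : ℂ) := by
          refine sum_congr rfl fun m _ => ?_
          rw [Complex.ofReal_pow, ← Complex.mul_conj', expSum, map_sum, sum_mul_sum]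
          refine sum_congr rfl fun i _ => sum_congr rfl fun j _ => ?_
          rw [← AddChar.map_neg_eq_conj, ← AddChar.map_add_eq_mul]
          congr 1
          ring
      _ = ∑ i, ∑ j, ∑ m, (ZMod.stdAddChar (m * (b i - b j)) : ℂ) := by
          rw [sum_comm]
          exact sum_congr rfl fun i _ => sum_comm
      _ = ∑ i : ι, ∑ j : ι, if i = j then (d : ℂ) else 0 := by
          refine sum_congr rfl fun i _ => sum_congr rfl fun j _ => ?_
          rw [AddChar.sum_mulShift _ (ZMod.isPrimitive_stdAddChar d)]
          simp [sub_eq_zero, hb.eq_iff]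
      _ = d * Fintype.card ι := by simp [mul_comm]
  exact_mod_cast key

lemma norm_expSum_coset_sq_le (H : Subgroup (ZMod d)ˣ) [Fintype H] (x : (ZMod d)ˣ) {n : ℤ}
    (hn : n ≠ 0) :
    ‖expSum (fun h : H => ((x * h : (ZMod d)ˣ) : ZMod d)) n‖ ^ 2 ≤ n.natAbs * d := by
  classical
  set b : H → ZMod d := fun h => ((x * h : (ZMod d)ˣ) : ZMod d) with hbdef
  have hb : b.Injective := fun h h' e => Subtype.ext (mul_left_cancel (Units.ext e))
  have hinv (m : ZMod d) (u : H) : expSum b (m * (u : (ZMod d)ˣ)) = expSum b m := by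
    refine Fintype.sum_equiv (Equiv.mulLeft u) _ _ fun h => ?_
    congr 1
    simp only [hbdef, Equiv.coe_mulLeft, Subgroup.coe_mul, Units.val_mul]
    ring
  have hH : (0 : ℝ) < Fintype.card H := by exact_mod_cast Fintype.card_pos
  set φ : H → ZMod d := fun u => n * ((u : (ZMod d)ˣ) : ZMod d)
  refine le_of_mul_le_mul_left ?_ hH
  calc (Fintype.card H : ℝ) * ‖expSum b n‖ ^ 2
      = ∑ u : H, ‖expSum b (φ u)‖ ^ 2 := by simp [φ, hinv]
    _ = ∑ m, ∑ u with φ u = m, ‖expSum b m‖ ^ 2 :=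
        (sum_fiberwise' univ φ fun m => ‖expSum b m‖ ^ 2).symm
    _ ≤ ∑ m, (n.natAbs : ℝ) * ‖expSum b m‖ ^ 2 := by
        refine sum_le_sum fun m _ => ?_
        rw [sum_const, nsmul_eq_mul]
        gcongr
        refine le_trans ?_ (card_intCast_mul_eq_le hn m)
        refine card_le_card_of_injOn (fun u : H => ((u : (ZMod d)ˣ) : ZMod d))
          (fun u hu => ?_) fun u _ v _ e => Subtype.ext (Units.ext e)
        simpa using hu
    _ = Fintype.card H * (n.natAbs * d) := by
        rw [← mul_sum, sum_norm_expSum_sq hb]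
        ring

end ExponentialSum

/-- The averages of `q` over the cosets of subgroups of `(ℤ/dℤ)ˣ` of index at most `k`, placed on
the circle through `b ↦ b / d`, converge uniformly to the integral of `q` as `d → ∞`. -/
def CosetAveragesConverge (k : ℕ) (q : C(UnitAddCircle, ℂ)) : Prop :=
  ∀ ε : ℝ, 0 < ε → ∃ d₀ : ℕ, ∀ (d : ℕ) [NeZero d], d₀ < d →
    ∀ (H : Subgroup (ZMod d)ˣ) [Fintype H], H.index ≤ k → ∀ x : (ZMod d)ˣ,
      ‖∑ h : H, (q (ZMod.toAddCircle ((x * h : (ZMod d)ˣ) : ZMod d)) - ∫ t, q t ∂haarAddCircle)‖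
        ≤ ε * Fintype.card H

namespace CosetAveragesConverge

variable {k : ℕ}

lemma fourier_toAddCircle {d : ℕ} [NeZero d] (n : ℤ) (b : ZMod d) :
    fourier n (ZMod.toAddCircle b) = ZMod.stdAddChar ((n : ZMod d) * b) := by
  obtain ⟨j, rfl⟩ := ZMod.intCast_surjective b
  rw [← Int.cast_mul, ZMod.stdAddChar_coe, ZMod.toAddCircle_intCast, fourier_coe_apply]
  congr 1
  push_cast
  ring

lemma integral_fourier (n : ℤ) :
    ∫ t : UnitAddCircle, fourier n t ∂haarAddCircle = if n = 0 then 1 else 0 := by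
  have h := congrFun (fourierCoeff_fourier (T := 1) n) 0
  simpa [fourierCoeff, Pi.single_apply, eq_comm] using h

lemma fourier (n : ℤ) : CosetAveragesConverge k (fourier n) := by
  intro ε hε
  rcases eq_or_ne n 0 with rfl | hn
  · refine ⟨0, fun d _ _ H _ _ x => ?_⟩
    rw [integral_fourier]
    simp
    positivity
  obtain ⟨d₀, hd₀⟩ := exists_nat_gt (64 * ((n.natAbs : ℝ) * k ^ 2 / ε ^ 2) ^ 2)
  refine ⟨d₀, fun d _ hd H _ hH x => ?_⟩
  simp only [integral_fourier, if_neg hn, sub_zero, fourier_toAddCircle]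
  have hsum := norm_expSum_coset_sq_le H x hn
  rw [expSum] at hsum
  have hd0 : (0 : ℝ) < d := by exact_mod_cast NeZero.pos d
  have hd1 : 64 * ((n.natAbs : ℝ) * k ^ 2 / ε ^ 2) ^ 2 ≤ d :=
    hd₀.le.trans (by exact_mod_cast hd.le)
  have hcard : (d.totient : ℝ) ≤ Fintype.card H * k := by
    have h := H.card_mul_index
    rw [Nat.card_eq_fintype_card, Nat.card_eq_fintype_card, ZMod.card_units_eq_totient] at h
    rw [← h]
    exact_mod_cast Nat.mul_le_mul_left _ hH
  have htot := pow_three_le_totient_pow_four d (NeZero.ne d)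
  have hbig : (n.natAbs : ℝ) * k ^ 2 / ε ^ 2 * d ≤ (d.totient : ℝ) ^ 2 := by
    refine (sq_le_sq₀ (by positivity) (by positivity)).1 ?_
    have : 64 * ((n.natAbs : ℝ) * k ^ 2 / ε ^ 2) ^ 2 * (d : ℝ) ^ 2 ≤ d * (d : ℝ) ^ 2 := by gcongr
    nlinarith
  have hk : (0 : ℝ) < k := by
    have : 0 < H.index := Nat.pos_of_ne_zero H.index_ne_zero_of_finite
    exact_mod_cast this.trans_le hH
  refine (sq_le_sq₀ (norm_nonneg _) (by positivity)).1 (hsum.trans ?_)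
  have h1 : (n.natAbs : ℝ) * k ^ 2 / ε ^ 2 * d ≤ (Fintype.card H * k : ℝ) ^ 2 :=
    hbig.trans (by gcongr)
  rw [div_mul_eq_mul_div, div_le_iff₀ (by positivity)] at h1
  refine le_of_mul_le_mul_right ?_ (by positivity : (0 : ℝ) < k ^ 2)
  linarith

lemma zero : CosetAveragesConverge k 0 := fun ε hε => ⟨0, fun d _ _ H _ _ x => by
  simp
  positivity⟩

lemma integrable (q : C(UnitAddCircle, ℂ)) : Integrable q haarAddCircle :=
  q.continuous.integrable_of_hasCompactSupport (HasCompactSupport.of_compactSpace _)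

lemma add {p q : C(UnitAddCircle, ℂ)} (hp : CosetAveragesConverge k p)
    (hq : CosetAveragesConverge k q) : CosetAveragesConverge k (p + q) := by
  intro ε hε
  obtain ⟨d₁, h₁⟩ := hp (ε / 2) (by positivity)
  obtain ⟨d₂, h₂⟩ := hq (ε / 2) (by positivity)
  refine ⟨max d₁ d₂, fun d _ hd H _ hH x => ?_⟩
  have e₁ := h₁ d ((le_max_left _ _).trans_lt hd) H hH x
  have e₂ := h₂ d ((le_max_right _ _).trans_lt hd) H hH x
  simp only [ContinuousMap.add_apply]
  rw [integral_add (integrable p) (integrable q)]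
  simp only [add_sub_add_comm]
  rw [sum_add_distrib]
  refine (norm_add_le _ _).trans ?_
  linarith

lemma smul {q : C(UnitAddCircle, ℂ)} (c : ℂ) (hq : CosetAveragesConverge k q) :
    CosetAveragesConverge k (c • q) := by
  intro ε hε
  obtain ⟨d₀, h₀⟩ := hq (ε / (‖c‖ + 1)) (by positivity)
  refine ⟨d₀, fun d _ hd H _ hH x => ?_⟩
  have e := h₀ d hd H hH x
  simp only [ContinuousMap.smul_apply, smul_eq_mul]
  rw [integral_const_mul]
  simp only [← mul_sub]
  rw [← mul_sum, norm_mul]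
  calc ‖c‖ * _ ≤ (‖c‖ + 1) * (ε / (‖c‖ + 1) * Fintype.card H) := by
        gcongr
        linarith
    _ = ε * Fintype.card H := by field_simp

lemma of_mem_closure {s : Set C(UnitAddCircle, ℂ)} (hs : ∀ p ∈ s, CosetAveragesConverge k p)
    {q : C(UnitAddCircle, ℂ)} (hq : q ∈ closure s) : CosetAveragesConverge k q := by
  intro ε hε
  obtain ⟨p, hps, hpq⟩ := Metric.mem_closure_iff.1 hq (ε / 3) (by positivity)
  obtain ⟨d₀, h₀⟩ := hs p hps (ε / 3) (by positivity)
  refine ⟨d₀, fun d _ hd H _ hH x => ?_⟩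
  have e := h₀ d hd H hH x
  have hpt (t : UnitAddCircle) : ‖q t - p t‖ ≤ ε / 3 := by
    rw [← dist_eq_norm]
    exact (ContinuousMap.dist_apply_le_dist t).trans hpq.le
  have hint : ‖(∫ t, q t ∂haarAddCircle) - ∫ t, p t ∂haarAddCircle‖ ≤ ε / 3 := by
    rw [← integral_sub (integrable q) (integrable p)]
    simpa using norm_integral_le_of_norm_le_const (μ := haarAddCircle) (.of_forall hpt)
  set φ : H → UnitAddCircle := fun h => ZMod.toAddCircle ((x * h : (ZMod d)ˣ) : ZMod d)
  have hsplit : ∑ h : H, (q (φ h) - ∫ t, q t ∂haarAddCircle) =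
      ∑ h : H, ((q (φ h) - p (φ h)) -
        ((∫ t, q t ∂haarAddCircle) - ∫ t, p t ∂haarAddCircle)) +
      ∑ h : H, (p (φ h) - ∫ t, p t ∂haarAddCircle) := by
    rw [← sum_add_distrib]
    exact sum_congr rfl fun h _ => by ring
  have hdiff : ‖∑ h : H, ((q (φ h) - p (φ h)) -
      ((∫ t, q t ∂haarAddCircle) - ∫ t, p t ∂haarAddCircle))‖ ≤
      Fintype.card H * (ε / 3 + ε / 3) := by
    refine (norm_sum_le_of_le _ fun h _ =>
      (norm_sub_le _ _).trans (add_le_add (hpt (φ h)) hint)).trans ?_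
    rw [sum_const, nsmul_eq_mul, card_univ]
  rw [hsplit]
  refine (norm_add_le _ _).trans ((add_le_add hdiff e).trans_eq ?_)
  ring

theorem of_continuousMap (q : C(UnitAddCircle, ℂ)) : CosetAveragesConverge k q := by
  have hq : q ∈ closure (Submodule.span ℂ (Set.range (@_root_.fourier 1)) : Set _) := by
    rw [← Submodule.topologicalClosure_coe, span_fourier_closure_eq_top]
    trivial
  refine of_mem_closure (fun p hp => ?_) hq
  induction hp using Submodule.span_induction with
  | mem p hp =>
    obtain ⟨n, rfl⟩ := hp
    exact CosetAveragesConverge.fourier n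
  | zero => exact zero
  | add p q _ _ hp hq => exact hp.add hq
  | smul c p _ hp => exact hp.smul c

end CosetAveragesConverge

lemma exists_coset_mem_of_continuous (k : ℕ) {f : UnitAddCircle → ℝ} (hf : Continuous f)
    (hf0 : 0 ≤ f) {t₀ : UnitAddCircle} (ht₀ : f t₀ ≠ 0) :
    ∃ d₀ : ℕ, ∀ (d : ℕ) [NeZero d], d₀ < d →
      ∀ H : Subgroup (ZMod d)ˣ, H.index ≤ k → ∀ x : (ZMod d)ˣ,
        ∃ h ∈ H, f (ZMod.toAddCircle ((x * h : (ZMod d)ˣ) : ZMod d)) ≠ 0 := by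
  classical
  have hpos : 0 < ∫ t, f t ∂haarAddCircle :=
    hf.integral_pos_of_hasCompactSupport_nonneg_nonzero (HasCompactSupport.of_compactSpace _)
      hf0 ht₀
  set I := ∫ t, f t ∂haarAddCircle
  obtain ⟨d₀, h₀⟩ := CosetAveragesConverge.of_continuousMap (k := k)
    ⟨fun t => (f t : ℂ), Complex.continuous_ofReal.comp hf⟩ (I / 2) (by positivity)
  refine ⟨d₀, fun d _ hd H hH x => ?_⟩
  by_contra! hzero
  have e := h₀ d hd H hH x
  have hint : ∫ t, (f t : ℂ) ∂haarAddCircle = (I : ℂ) := integral_ofReal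
  have hcard : (0 : ℝ) < Fintype.card H := by exact_mod_cast Fintype.card_pos
  simp only [ContinuousMap.coe_mk, hint, hzero _ (Subtype.coe_prop _), Complex.ofReal_zero,
    zero_sub, sum_const, card_univ, nsmul_eq_mul, norm_mul, norm_neg, Complex.norm_natCast,
    Complex.norm_real, Real.norm_of_nonneg hpos.le] at e
  nlinarith

/-- For every positive integer `g` and reals `0 ≤ α < β ≤ 1` there is `d₀` such that
for all `d > d₀` and every subgroup `H ≤ (ℤ/dℤ)ˣ` of index at most `2g`, every coset
of `H` contains an element whose least positive residue `b` satisfies `αd < b < βd`. -/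
theorem stmt8 (g : ℕ) (hg : 0 < g) (α β : ℝ) (hα : 0 ≤ α) (hαβ : α < β) (hβ : β ≤ 1) :
    ∃ d₀ : ℕ, ∀ d : ℕ, d₀ < d →
      ∀ H : Subgroup (ZMod d)ˣ, H.index ≤ 2 * g →
        ∀ x : (ZMod d)ˣ, ∃ h ∈ H,
          α * d < (((x * h : (ZMod d)ˣ) : ZMod d).val : ℝ) ∧
            (((x * h : (ZMod d)ˣ) : ZMod d).val : ℝ) < β * d := by
  set f : ℝ → ℝ := fun t => max 0 (min (t - α) (β - t)) with hf
  have hf_end : f 0 = f 1 := by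
    have h0 : f 0 = 0 := max_eq_left ((min_le_left _ _).trans (by linarith))
    have h1 : f 1 = 0 := max_eq_left ((min_le_right _ _).trans (by linarith))
    rw [h0, h1]
  have hcont : Continuous (liftIco 1 0 f) :=
    liftIco_zero_continuous hf_end (by fun_prop)
  have hnonneg : 0 ≤ liftIco 1 0 f := fun t => le_max_left _ _
  have hmid : liftIco 1 0 f (((α + β) / 2 : ℝ) : UnitAddCircle) ≠ 0 := by
    rw [liftIco_zero_coe_apply ⟨by linarith, by linarith⟩]
    exact (lt_max_of_lt_right (lt_min (by linarith) (by linarith))).ne'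
  obtain ⟨d₀, h₀⟩ := exists_coset_mem_of_continuous (2 * g) hcont hnonneg hmid
  refine ⟨d₀, fun d hd H hH x => ?_⟩
  have : NeZero d := ⟨by omega⟩
  obtain ⟨h, hh, hne⟩ := h₀ d hd H hH x
  refine ⟨h, hh, ?_⟩
  set b : ZMod d := ((x * h : (ZMod d)ˣ) : ZMod d)
  have hd0 : (0 : ℝ) < d := by exact_mod_cast NeZero.pos d
  have hb : (b.val : ℝ) < d := by exact_mod_cast b.val_lt
  rw [ZMod.toAddCircle_apply,
    liftIco_zero_coe_apply ⟨by positivity, (div_lt_one hd0).2 hb⟩] at hne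
  have hpos : 0 < min ((b.val : ℝ) / d - α) (β - b.val / d) := by
    by_contra! hle
    exact hne (max_eq_left hle)
  obtain ⟨h1, h2⟩ := lt_min_iff.1 hpos
  exact ⟨(lt_div_iff₀ hd0).1 (by linarith), (div_lt_iff₀ hd0).1 (by linarith)⟩
end

section
/- For all positive integers n and g there is a constant d₀ depending only on n and g with the following property: if d > d₀, K ⊂ ℂ is a number field with [K:ℚ] ≤ 2g, and P is an irreducible polynomial of positive degree with coefficients in K having a primitive d-th root of unity as a root, then P has a root of the form e^{2πib/d} where b is an integer satisfying 0 < b < d/n and gcd(b, d) = 1. -/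
open Complex Polynomial

theorem sq_le_totient_pow_three_mul_gcd (d : ℕ) :
    d ^ 2 ≤ d.totient ^ 3 * (Nat.gcd 2 d ^ 2 * Nat.gcd 3 d) := by
  induction d using Nat.recOnPosPrimePosCoprime with
  | zero => simp
  | one => simp
  | prime_pow p n hp hn =>
    obtain ⟨k, rfl⟩ := Nat.exists_eq_succ_of_ne_zero hn.ne'
    rw [Nat.totient_prime_pow_succ hp, Nat.succ_eq_add_one]
    have hpk : (p ^ k) ^ 2 ≤ (p ^ k) ^ 3 := Nat.pow_le_pow_right (pow_pos hp.pos k) (by norm_num)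
    suffices h : p ^ 2 ≤ (p - 1) ^ 3 * (Nat.gcd 2 (p ^ (k + 1)) ^ 2 * Nat.gcd 3 (p ^ (k + 1))) by
      calc (p ^ (k + 1)) ^ 2 = (p ^ k) ^ 2 * p ^ 2 := by ring
        _ ≤ (p ^ k) ^ 3 * _ := Nat.mul_le_mul hpk h
        _ = _ := by ring
    have hdvd : p ∣ p ^ (k + 1) := dvd_pow_self p (by omega)
    have h2 : 0 < Nat.gcd 2 (p ^ (k + 1)) := Nat.gcd_pos_of_pos_left _ (by norm_num)
    have h3 : 0 < Nat.gcd 3 (p ^ (k + 1)) := Nat.gcd_pos_of_pos_left _ (by norm_num)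
    rcases lt_or_ge p 5 with h5 | h5
    · have := hp.two_le
      interval_cases p
      · rw [Nat.gcd_eq_left hdvd]; omega
      · rw [Nat.gcd_eq_left hdvd]; nlinarith
      · exact absurd hp (by norm_num)
    · obtain ⟨q, rfl⟩ : ∃ q, p = q + 5 := ⟨p - 5, by omega⟩
      calc (q + 5) ^ 2 ≤ (q + 5 - 1) ^ 3 * 1 := by
            rw [show q + 5 - 1 = q + 4 by omega]; nlinarith [Nat.zero_le (q ^ 3), Nat.zero_le (q ^ 2)]
        _ ≤ _ := Nat.mul_le_mul_left _ (Nat.mul_pos (pow_pos h2 2) h3)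
  | coprime a b _ _ hab iha ihb =>
    rw [Nat.totient_mul hab, hab.gcd_mul, hab.gcd_mul]
    calc (a * b) ^ 2 = a ^ 2 * b ^ 2 := by ring
      _ ≤ _ := Nat.mul_le_mul iha ihb
      _ = _ := by ring

theorem sq_le_twelve_mul_totient_pow_three (d : ℕ) : d ^ 2 ≤ 12 * d.totient ^ 3 := by
  refine (sq_le_totient_pow_three_mul_gcd d).trans ?_
  rw [mul_comm]
  refine Nat.mul_le_mul_right _ ?_
  have h2 := Nat.gcd_le_left d (m := 2) (by norm_num)
  have h3 := Nat.gcd_le_left d (m := 3) (by norm_num)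
  calc Nat.gcd 2 d ^ 2 * Nat.gcd 3 d ≤ 2 ^ 2 * 3 := by gcongr
    _ = 12 := by norm_num

theorem card_intCast_mul_eq_zero_le (d : ℕ) [NeZero d] {k : ℤ} (hk : k ≠ 0) :
    (Finset.univ.filter fun x : ZMod d => (k : ZMod d) * x = 0).card ≤ k.natAbs := by
  refine le_trans (Finset.card_le_card fun x hx => ?_)
    (IsAddCyclic.card_nsmul_eq_zero_le (α := ZMod d) (Int.natAbs_pos.mpr hk))
  simp only [Finset.mem_filter, Finset.mem_univ, true_and] at hx ⊢
  rcases Int.natAbs_eq k with h | h <;> rw [h] at hx <;> simpa using hx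

open Classical in
theorem norm_sum_stdAddChar_subgroup_sq_le (d : ℕ) [NeZero d] (H : Subgroup (ZMod d)ˣ)
    (a : (ZMod d)ˣ) {k : ℤ} (hk : k ≠ 0) :
    ‖∑ h : H, ZMod.stdAddChar ((k : ZMod d) * ((a : ZMod d) * ((h : (ZMod d)ˣ) : ZMod d)))‖ ^ 2
      ≤ d * k.natAbs := by
  set F : ZMod d → ℂ := fun t => ∑ h : H, ZMod.stdAddChar ((k : ZMod d) * (t * ((h : (ZMod d)ˣ) : ZMod d)))
    with hF
  have hcard : 0 < (Fintype.card H : ℝ) := by exact_mod_cast Fintype.card_pos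
  have hinv (g : H) : F ((a : ZMod d) * ((g : (ZMod d)ˣ) : ZMod d)) = F a := by
    refine Fintype.sum_equiv (Equiv.mulLeft g) _ _ fun h => ?_
    simp [mul_assoc]
  have hsum : ((∑ t, ‖F t‖ ^ 2 : ℝ) : ℂ) = ((∑ h : H, ∑ h' : H,
      if (k : ZMod d) * (((h' : (ZMod d)ˣ) : ZMod d) - ((h : (ZMod d)ˣ) : ZMod d)) = 0 then (d : ℝ) else 0 :
        ℝ) : ℂ) := by
    push_cast
    have (t : ZMod d) : ((‖F t‖ : ℂ)) ^ 2 = ∑ h : H, ∑ h' : H,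
        ZMod.stdAddChar (t * ((k : ZMod d) * (((h' : (ZMod d)ˣ) : ZMod d) - ((h : (ZMod d)ˣ) : ZMod d)))) := by
      rw [← Complex.conj_mul', hF]
      simp only [map_sum, Finset.sum_mul_sum, ← AddChar.map_neg_eq_conj, ← AddChar.map_add_eq_mul]
      refine Finset.sum_congr rfl fun h _ => Finset.sum_congr rfl fun h' _ => ?_
      congr 1; ring
    simp_rw [this]
    rw [Finset.sum_comm]
    refine Finset.sum_congr rfl fun h _ => ?_
    rw [Finset.sum_comm]
    refine Finset.sum_congr rfl fun h' _ => ?_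
    rw [AddChar.sum_mulShift _ (ZMod.isPrimitive_stdAddChar d), ZMod.card]
    split_ifs <;> simp
  rw [Complex.ofReal_inj] at hsum
  have hinner (h : H) : (∑ h' : H,
      if (k : ZMod d) * (((h' : (ZMod d)ˣ) : ZMod d) - ((h : (ZMod d)ˣ) : ZMod d)) = 0 then (d : ℝ) else 0)
        ≤ d * k.natAbs := by
    rw [← Finset.sum_filter, Finset.sum_const, nsmul_eq_mul, mul_comm]
    gcongr
    refine le_trans (Finset.card_le_card_of_injOn
      (fun h' : H => ((h' : (ZMod d)ˣ) : ZMod d) - ((h : (ZMod d)ˣ) : ZMod d)) (fun x hx => ?_)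
      fun x _ y _ hxy => ?_) (card_intCast_mul_eq_zero_le d hk)
    · simpa using hx
    · exact Subtype.ext (Units.ext (sub_left_injective hxy))
  have hlow : (Fintype.card H : ℝ) * ‖F a‖ ^ 2 ≤ ∑ t, ‖F t‖ ^ 2 := by
    calc (Fintype.card H : ℝ) * ‖F a‖ ^ 2
        = ∑ g : H, ‖F ((a : ZMod d) * ((g : (ZMod d)ˣ) : ZMod d))‖ ^ 2 := by simp [hinv]
      _ = ∑ t ∈ Finset.univ.image (fun g : H => ((a : ZMod d) * ((g : (ZMod d)ˣ) : ZMod d))), ‖F t‖ ^ 2 := by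
          rw [Finset.sum_image]
          intro x _ y _ hxy
          exact Subtype.ext (Units.ext (a.isUnit.mul_right_injective hxy))
      _ ≤ _ := Finset.sum_le_sum_of_subset_of_nonneg (Finset.subset_univ _)
          fun _ _ _ => by positivity
  have hup : ∑ t, ‖F t‖ ^ 2 ≤ (Fintype.card H : ℝ) * (d * k.natAbs) := by
    rw [hsum]
    refine (Finset.sum_le_sum fun h _ => hinner h).trans ?_
    simp
  exact le_of_mul_le_mul_left (hlow.trans hup) hcard

theorem mul_card_le_sum_norm_geom_sum_sq_add {ι : Type*} [Fintype ι] {w : ι → ℂ}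
    (hw : ∀ i, ‖w i‖ = 1) {N : ℕ} {M : ℝ} (hM : 0 ≤ M)
    (h : ∀ k : ℤ, k ≠ 0 → k.natAbs ≤ N → ‖∑ i, w i ^ k‖ ≤ M) :
    (N : ℝ) * Fintype.card ι ≤ ∑ i, ‖∑ j ∈ Finset.range N, w i ^ j‖ ^ 2 + N ^ 2 * M := by
  have hsum : ((∑ i, ‖∑ j ∈ Finset.range N, w i ^ j‖ ^ 2 : ℝ) : ℂ) =
      ∑ l ∈ Finset.range N, ∑ j ∈ Finset.range N, ∑ i, w i ^ ((j : ℤ) - l) := by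
    push_cast
    have (i : ι) : ((‖∑ j ∈ Finset.range N, w i ^ j‖ : ℂ)) ^ 2 =
        ∑ l ∈ Finset.range N, ∑ j ∈ Finset.range N, w i ^ ((j : ℤ) - l) := by
      have h0 : w i ≠ 0 := fun h0 => by simpa [h0] using hw i
      rw [← Complex.conj_mul']
      simp only [map_sum, Finset.sum_mul_sum, map_pow, ← Complex.inv_eq_conj (hw i)]
      refine Finset.sum_congr rfl fun l _ => Finset.sum_congr rfl fun j _ => ?_
      rw [zpow_sub₀ h0, zpow_natCast, zpow_natCast, inv_pow, div_eq_inv_mul]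
    simp_rw [this]
    rw [Finset.sum_comm]
    exact Finset.sum_congr rfl fun l _ => Finset.sum_comm
  have hdiag : ∑ l ∈ Finset.range N, ∑ j ∈ Finset.range N,
      (if j = l then (Fintype.card ι : ℂ) else 0) = N * Fintype.card ι := by
    rw [Finset.sum_congr rfl fun l hl => by rw [Finset.sum_ite_eq', if_pos hl]]
    simp
  have hbound : ‖((∑ i, ‖∑ j ∈ Finset.range N, w i ^ j‖ ^ 2 : ℝ) : ℂ) - N * Fintype.card ι‖
      ≤ N ^ 2 * M := by
    rw [hsum, ← hdiag, ← Finset.sum_sub_distrib]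
    simp_rw [← Finset.sum_sub_distrib]
    refine (norm_sum_le_of_le _ fun l hl => norm_sum_le_of_le (f := fun j => _)
      (n := fun _ => M) _ fun j hj => ?_).trans (by simp [sq, mul_assoc])
    rw [Finset.mem_range] at hl hj
    beta_reduce
    split_ifs with hjl
    · simpa [hjl] using hM
    · simpa using h (j - l) (by omega) (by omega)
  rw [← Complex.ofReal_natCast, ← Complex.ofReal_natCast (Fintype.card ι), ← Complex.ofReal_mul,
    ← Complex.ofReal_sub, Complex.norm_real, Real.norm_eq_abs] at hbound
  linarith [neg_le_of_abs_le hbound]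

theorem norm_geom_sum_sq_le {w : ℂ} (hw : ‖w‖ = 1) {q : ℝ} (hq : 0 < q)
    (h : q ≤ ‖w - 1‖ ^ 2) (N : ℕ) : ‖∑ j ∈ Finset.range N, w ^ j‖ ^ 2 ≤ 4 / q := by
  have h1 : ‖∑ j ∈ Finset.range N, w ^ j‖ * ‖w - 1‖ ≤ 2 := by
    rw [← norm_mul, geom_sum_mul]
    refine (norm_sub_le _ _).trans ?_
    simp [hw]; norm_num
  rw [le_div_iff₀ hq]
  calc ‖∑ j ∈ Finset.range N, w ^ j‖ ^ 2 * q
      ≤ ‖∑ j ∈ Finset.range N, w ^ j‖ ^ 2 * ‖w - 1‖ ^ 2 := by gcongr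
    _ = (‖∑ j ∈ Finset.range N, w ^ j‖ * ‖w - 1‖) ^ 2 := by ring
    _ ≤ 2 ^ 2 := by gcongr
    _ = 4 := by norm_num

theorem norm_exp_mul_I_sub_one_sq (θ : ℝ) : ‖Complex.exp (θ * I) - 1‖ ^ 2 = 2 - 2 * Real.cos θ := by
  rw [Complex.sq_norm, Complex.normSq_apply]
  simp only [sub_re, sub_im, exp_ofReal_mul_I_re, exp_ofReal_mul_I_im, one_re, one_im]
  nlinarith [Real.sin_sq_add_cos_sq θ]

/-- A coset in `(ℤ/dℤ)ˣ` missing the residues below `d / n` has at most `O_n(√d)` elements. -/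
theorem exists_forall_card_sq_le_of_coset_misses_interval (n : ℕ) (hn : 0 < n) :
    ∃ N : ℕ, 0 < N ∧ ∀ (d : ℕ) [NeZero d] (H : Subgroup (ZMod d)ˣ) (a : (ZMod d)ˣ),
      (∀ h ∈ H, (d : ℝ) / n ≤ ((a * h : (ZMod d)ˣ) : ZMod d).val) →
        Nat.card H ^ 2 ≤ 4 * N ^ 3 * d := by
  classical
  have hn' : (0 : ℝ) < n := by exact_mod_cast hn
  have hn1 : (1 : ℝ) ≤ n := by exact_mod_cast hn
  have hpi := Real.pi_pos
  have hpin : Real.pi / n ≤ Real.pi := div_le_self hpi.le hn1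
  set q : ℝ := 2 - 2 * Real.cos (Real.pi / n) with hq_def
  have hq : 0 < q := by
    have := Real.cos_lt_cos_of_nonneg_of_le_pi le_rfl hpin (by positivity : 0 < Real.pi / n)
    rw [Real.cos_zero] at this
    linarith
  obtain ⟨N, hN⟩ := exists_nat_ge (8 / q)
  have hN0 : (0 : ℝ) < N := lt_of_lt_of_le (by positivity) hN
  refine ⟨N, by exact_mod_cast hN0, fun d _ H a hmiss => ?_⟩
  have hd : (0 : ℝ) < d := by exact_mod_cast Nat.pos_of_neZero d
  set c : ℂ := Complex.exp ((-(Real.pi / n) : ℝ) * I) with hc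
  have hc1 : ‖c‖ = 1 := Complex.norm_exp_ofReal_mul_I _
  set w : H → ℂ := fun h => c * ZMod.stdAddChar ((a : ZMod d) * ((h : (ZMod d)ˣ) : ZMod d)) with hw_def
  have hw (h : H) : ‖w h‖ = 1 := by simp [hw_def, hc1]
  have hpow (k : ℤ) (hk : k ≠ 0) (hkN : k.natAbs ≤ N) :
      ‖∑ h, w h ^ k‖ ≤ Real.sqrt (d * N) := by
    have hmul : ∑ h, w h ^ k = c ^ k *
        ∑ h : H, ZMod.stdAddChar ((k : ZMod d) * ((a : ZMod d) * ((h : (ZMod d)ˣ) : ZMod d))) := by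
      rw [Finset.mul_sum]
      refine Finset.sum_congr rfl fun h _ => ?_
      rw [hw_def, mul_zpow, ← AddChar.map_zsmul_eq_zpow, zsmul_eq_mul]
    rw [hmul, norm_mul, norm_zpow, hc1, one_zpow, one_mul]
    refine Real.le_sqrt_of_sq_le ((norm_sum_stdAddChar_subgroup_sq_le d H a hk).trans ?_)
    gcongr
  have hmain := mul_card_le_sum_norm_geom_sum_sq_add hw (Real.sqrt_nonneg _) hpow
  have hfar (h : H) : q ≤ ‖w h - 1‖ ^ 2 := by
    set b : ℕ := ((a * h : (ZMod d)ˣ) : ZMod d).val with hb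
    have hbn : (d : ℝ) / n ≤ b := hmiss h h.2
    have hbd : (b : ℝ) ≤ d := by exact_mod_cast (ZMod.val_lt _).le
    have hwexp : w h = Complex.exp ((2 * Real.pi * (b / d) - Real.pi / n : ℝ) * I) := by
      rw [hw_def, hc]
      simp only
      rw [ZMod.stdAddChar_apply, ZMod.toCircle_apply, ← Units.val_mul, ← hb, ← Complex.exp_add]
      congr 1
      push_cast
      ring
    have h1 : 1 / (n : ℝ) ≤ b / d := by
      rw [div_le_div_iff₀ hn' hd]; rw [div_le_iff₀ hn'] at hbn; linarith
    have h2 : (b : ℝ) / d ≤ 1 := (div_le_one hd).mpr hbd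
    have h1' : Real.pi / n ≤ Real.pi * (b / d) := by
      calc Real.pi / n = Real.pi * (1 / n) := by ring
        _ ≤ _ := by gcongr
    have h2' : Real.pi * (b / d) ≤ Real.pi := by nlinarith
    rw [hwexp, norm_exp_mul_I_sub_one_sq, hq_def]
    set θ := 2 * Real.pi * (b / d) - Real.pi / n with hθ
    have : Real.cos θ ≤ Real.cos (Real.pi / n) := by
      rcases le_total θ Real.pi with hle | hge
      · exact Real.cos_le_cos_of_nonneg_of_le_pi (by positivity) hle (by linarith)
      · rw [← Real.cos_two_pi_sub θ]
        exact Real.cos_le_cos_of_nonneg_of_le_pi (by positivity) (by linarith) (by linarith)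
    linarith
  have hup : ∑ h, ‖∑ j ∈ Finset.range N, w h ^ j‖ ^ 2 ≤ Fintype.card H * (N / 2) := by
    refine (Finset.sum_le_sum fun h _ => norm_geom_sum_sq_le (hw h) hq (hfar h) N).trans ?_
    rw [Finset.sum_const, Finset.card_univ, nsmul_eq_mul]
    refine mul_le_mul_of_nonneg_left ?_ (Nat.cast_nonneg _)
    linarith [show 8 / q = 2 * (4 / q) by ring]
  have hle : (Fintype.card H : ℝ) ≤ 2 * N * Real.sqrt (d * N) := by
    refine le_of_mul_le_mul_left ?_ hN0
    nlinarith
  have hsq : (Fintype.card H : ℝ) ^ 2 ≤ 4 * N ^ 3 * d := by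
    calc (Fintype.card H : ℝ) ^ 2 ≤ (2 * N * Real.sqrt (d * N)) ^ 2 := by gcongr
      _ = 4 * N ^ 2 * (Real.sqrt (d * N) ^ 2) := by ring
      _ = 4 * N ^ 3 * d := by rw [Real.sq_sqrt (by positivity)]; ring
  rw [Nat.card_eq_fintype_card]
  exact_mod_cast hsq

theorem exists_subgroup_pow_isRoot (K : IntermediateField ℚ ℂ) [FiniteDimensional ℚ K]
    {d : ℕ} [NeZero d] {z : ℂ} (hz : IsPrimitiveRoot z d) {P : K[X]}
    (hP : (P.map (algebraMap K ℂ)).IsRoot z) :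
    ∃ H : Subgroup (ZMod d)ˣ, d.totient ≤ Module.finrank ℚ K * Nat.card H ∧
      ∀ h ∈ H, (P.map (algebraMap K ℂ)).IsRoot (z ^ (h : ZMod d).val) := by
  have hzint : IsIntegral K z := (hz.isIntegral (NeZero.pos d)).tower_top
  let L := IntermediateField.adjoin K {z}
  have hLfin : FiniteDimensional K L := IntermediateField.adjoin.finiteDimensional hzint
  have hcyc : IsCyclotomicExtension {d} K L := by
    change IsCyclotomicExtension {d} K L.toSubalgebra
    rw [IntermediateField.adjoin_simple_toSubalgebra_of_isAlgebraic hzint.isAlgebraic]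
    exact hz.adjoin_isCyclotomicExtension K
  have hgal : IsGalois K L := IsCyclotomicExtension.isGalois {d} K L
  let ζ : L := IntermediateField.AdjoinSimple.gen K z
  have hζz : algebraMap L ℂ ζ = z := rfl
  have hζ : IsPrimitiveRoot ζ d :=
    IsPrimitiveRoot.of_map_of_injective (f := algebraMap L ℂ) hz (algebraMap L ℂ).injective
  refine ⟨(hζ.autToPow K).range, ?_, ?_⟩
  · have hcard : Nat.card (hζ.autToPow K).range = Module.finrank K L := by
      rw [← IsGalois.card_aut_eq_finrank K L]
      exact Nat.card_congr
        (MonoidHom.ofInjective (IsPrimitiveRoot.autToPow_injective K hζ)).toEquiv.symm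
    have : FiniteDimensional ℚ L := FiniteDimensional.trans ℚ K L
    rw [hcard, Module.finrank_mul_finrank ℚ K L, ← Polynomial.natDegree_cyclotomic d ℚ,
      Polynomial.cyclotomic_eq_minpoly_rat hζ (NeZero.pos d)]
    exact minpoly.natDegree_le ζ
  · rintro _ ⟨σ, rfl⟩
    have hPζ : aeval ζ P = 0 := by
      apply (algebraMap L ℂ).injective
      rw [map_zero, ← aeval_algebraMap_apply, hζz, aeval_def, ← eval_map]
      exact hP
    have hσ : aeval (ζ ^ ((hζ.autToPow K σ : (ZMod d)ˣ) : ZMod d).val) P = 0 := by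
      rw [hζ.autToPow_spec K σ, aeval_algHom_apply, hPζ, map_zero]
    rw [IsRoot.def, eval_map, ← aeval_def, ← hζz, ← map_pow, aeval_algebraMap_apply, hσ, map_zero]

/-- For all positive integers `n` and `g` there is a `d₀` depending only on `n` and
`g` such that: if `d > d₀`, `K ⊂ ℂ` is a number field with `[K:ℚ] ≤ 2g`, and `P` is
an irreducible polynomial of positive degree over `K` having a primitive `d`-th root
of unity as a root, then `P` has a root `e^{2πib/d}` with `0 < b < d/n` and
`gcd(b, d) = 1`. -/
theorem stmt13 (n g : ℕ) (hn : 0 < n) (hg : 0 < g) :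
    ∃ d₀ : ℕ, ∀ d : ℕ, d₀ < d →
      ∀ (K : IntermediateField ℚ ℂ) [FiniteDimensional ℚ K],
        Module.finrank ℚ K ≤ 2 * g →
          ∀ P : Polynomial K, Irreducible P → 0 < P.degree →
            (∃ z : ℂ, IsPrimitiveRoot z d ∧ (P.map (algebraMap K ℂ)).IsRoot z) →
            ∃ b : ℕ, 0 < b ∧ (b : ℝ) < (d : ℝ) / n ∧ Nat.gcd b d = 1 ∧
              (P.map (algebraMap K ℂ)).IsRoot (Complex.exp (2 * Real.pi * I * b / d)) := by
  obtain ⟨N, hN, hcoset⟩ := exists_forall_card_sq_le_of_coset_misses_interval n hn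
  refine ⟨144 * (2 * g) ^ 6 * (4 * N ^ 3) ^ 3, fun d hd K _ hK P _ _ ⟨z, hz, hPz⟩ => ?_⟩
  have hd1 : 1 < d := lt_of_le_of_lt (Nat.one_le_iff_ne_zero.mpr (by positivity)) hd
  have : NeZero d := ⟨by omega⟩
  have : Fact (1 < d) := ⟨hd1⟩
  obtain ⟨H, hHcard, hroot⟩ := exists_subgroup_pow_isRoot K hz hPz
  obtain ⟨i, _, hi, hzi⟩ := (Complex.isPrimitiveRoot_iff z d (NeZero.ne d)).mp hz
  have hsmall : ¬ Nat.card H ^ 2 ≤ 4 * N ^ 3 * d := by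
    intro hH
    have hφ : d.totient ≤ 2 * g * Nat.card H := hHcard.trans (Nat.mul_le_mul_right _ hK)
    have : d ^ 3 * d ≤ d ^ 3 * (144 * (2 * g) ^ 6 * (4 * N ^ 3) ^ 3) := by
      calc d ^ 3 * d = (d ^ 2) ^ 2 := by ring
        _ ≤ (12 * d.totient ^ 3) ^ 2 := by gcongr; exact sq_le_twelve_mul_totient_pow_three d
        _ ≤ (12 * (2 * g * Nat.card H) ^ 3) ^ 2 := by gcongr
        _ = 144 * (2 * g) ^ 6 * (Nat.card H ^ 2) ^ 3 := by ring
        _ ≤ 144 * (2 * g) ^ 6 * (4 * N ^ 3 * d) ^ 3 := by gcongr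
        _ = _ := by ring
    exact absurd (Nat.le_of_mul_le_mul_left this (by positivity)) (by omega)
  have hex := mt (hcoset d H (ZMod.unitOfCoprime i hi)) hsmall
  push Not at hex
  obtain ⟨h, hh, hlt⟩ := hex
  set u : (ZMod d)ˣ := ZMod.unitOfCoprime i hi * h with hu
  refine ⟨(u : ZMod d).val, ?_, hlt, ZMod.val_coe_unit_coprime u, ?_⟩
  · exact ZMod.val_pos.mpr u.ne_zero
  · convert hroot h hh using 1
    have hz' : z = ZMod.stdAddChar (i : ZMod d) := by
      rw [← hzi, ← Int.cast_natCast (R := ZMod d), ZMod.stdAddChar_coe]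
      congr 1
      push_cast
      ring
    rw [← ZMod.toCircle_apply, ← ZMod.stdAddChar_apply, hz', ← AddChar.map_nsmul_eq_pow, hu]
    simp [mul_comm]
end
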